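/- The pure braid group P_{m,n} is generated by the elements a_{ij} with 1 ≤ i < j, i ≤ m+n−1 and m+1 ≤ j ≤ m+n; that is, P_{m,n} equals the subgroup of B_{m+n} generated by this set of elements. -/

import Mathlib

open FreeGroup

namespace BraidPaper

/-- Relators for the Artin braid group on generators `σ_1, …, σ_n`
(so this presents the braid group `B_{n+1}`); the generator with index `k : Fin n`
represents `σ_{k+1}`. -/
def braidRels (n : ℕ) : Set (FreeGroup (Fin n)) :=
  {x | ∃ k l : Fin n, ((k : ℕ) + 2 ≤ (l : ℕ) ∨ (l : ℕ) + 2 ≤ (k : ℕ)) ∧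
      x = of k * of l * (of k)⁻¹ * (of l)⁻¹} ∪
  {x | ∃ k l : Fin n, (l : ℕ) = (k : ℕ) + 1 ∧
      x = of k * of l * of k * (of l)⁻¹ * (of k)⁻¹ * (of l)⁻¹}

/-- The braid group with `n` generators `σ_1, …, σ_n`, i.e. the Artin braid group
`B_{n+1}`.  Thus `B_N = BraidGroup (N-1)`. -/
abbrev BraidGroup (n : ℕ) : Type := PresentedGroup (braidRels n)

/-- The generator `σ_k` (1-based) of `BraidGroup n`, for `1 ≤ k ≤ n`. -/
def sgen (n k : ℕ) : BraidGroup n :=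
  if h : 1 ≤ k ∧ k ≤ n then PresentedGroup.of ⟨k - 1, by omega⟩ else 1

/-- The descending product `σ_{j-1} σ_{j-2} ⋯ σ_{i+1}`. -/
def dprod (n i j : ℕ) : BraidGroup n :=
  ((List.range (j - 1 - i)).map fun t => sgen n (j - 1 - t)).prod

/-- The pure braid generator
`a_{ij} = σ_{j-1} σ_{j-2} ⋯ σ_{i+1} σ_i² σ_{i+1}⁻¹ ⋯ σ_{j-2}⁻¹ σ_{j-1}⁻¹`. -/
def agen (n i j : ℕ) : BraidGroup n := dprod n i j * (sgen n i) ^ 2 * (dprod n i j)⁻¹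
/-- The generating set of the mixed braid group `B_{m,n} ≤ B_{m+n}`:
the pure generators `a_{ij}` with `1 ≤ i < j`, `m+1 ≤ j ≤ m+n`, together with
the crossings `σ_{m+1}, …, σ_{m+n-1}` among the last `n` strands. -/
def BmnSet (m n : ℕ) : Set (BraidGroup (m + n - 1)) :=
  {x | ∃ i j : ℕ, 1 ≤ i ∧ i < j ∧ m + 1 ≤ j ∧ j ≤ m + n ∧ x = agen (m + n - 1) i j} ∪
  {x | ∃ k : ℕ, m + 1 ≤ k ∧ k ≤ m + n - 1 ∧ x = sgen (m + n - 1) k}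

/-- The mixed braid group `B_{m,n}`, as a subgroup of `B_{m+n}`. -/
def Bmn (m n : ℕ) : Subgroup (BraidGroup (m + n - 1)) := Subgroup.closure (BmnSet m n)
/-! ### Groups generated by involutions satisfying the braid relations -/

section Involutions

variable {Q : Type*} [Group Q]

/-- The descending product `s_r s_{r-1} ⋯ s_{r-t+1}` of `t` factors. -/
def descProd (s : ℕ → Q) (r : ℕ) : ℕ → Q
  | 0 => 1
  | t + 1 => descProd s r t * s (r - t)

variable {s : ℕ → Q} {R : ℕ}

theorem descProd_commute_of_lt (hcomm : ∀ k l, k + 2 ≤ l → l < R → Commute (s k) (s l))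
    {r : ℕ} (hr : r < R) {t l : ℕ} (h : l + t < r) : Commute (descProd s r t) (s l) := by
  induction t with
  | zero => exact Commute.one_left _
  | succ t ih => exact (ih (by omega)).mul_left (hcomm _ _ (by omega) (by omega)).symm

theorem descProd_mul_of_gt
    (hbraid : ∀ l, l + 1 < R → s l * s (l + 1) * s l = s (l + 1) * s l * s (l + 1))
    (hcomm : ∀ k l, k + 2 ≤ l → l < R → Commute (s k) (s l))
    {r : ℕ} (hr : r < R) {t l : ℕ} (ht : t ≤ r + 1) (hl : l < r) (h : r < l + t) :
    descProd s r t * s (l + 1) = s l * descProd s r t := by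
  induction t with
  | zero => omega
  | succ t ih =>
    rcases (show r < l + t ∨ l = r - t by omega) with h1 | rfl
    · rw [descProd, mul_assoc, (hcomm (r - t) (l + 1) (by omega) (by omega)).eq, ← mul_assoc,
        ih (by omega) h1, mul_assoc]
    · obtain ⟨u, rfl⟩ : ∃ u, t = u + 1 := ⟨t - 1, by omega⟩
      have e : r - u = r - (u + 1) + 1 := by omega
      have hc : Commute (descProd s r u) (s (r - (u + 1))) :=
        descProd_commute_of_lt hcomm hr (by omega)
      rw [descProd, descProd, e]
      calc _ = descProd s r u * (s (r - (u + 1) + 1) * s (r - (u + 1)) * s (r - (u + 1) + 1)) := by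
            group
        _ = descProd s r u * s (r - (u + 1)) * (s (r - (u + 1) + 1) * s (r - (u + 1))) := by
            rw [← hbraid _ (by omega)]; group
        _ = _ := by rw [hc.eq]; group

theorem exists_eq_mul_descProd (hsq : ∀ l < R, s l * s l = 1)
    (hbraid : ∀ l, l + 1 < R → s l * s (l + 1) * s l = s (l + 1) * s l * s (l + 1))
    (hcomm : ∀ k l, k + 2 ≤ l → l < R → Commute (s k) (s l))
    {r : ℕ} (hr : r < R) {x : Q} (hx : x ∈ Subgroup.closure {y | ∃ l < r + 1, y = s l}) :
    ∃ h ∈ Subgroup.closure {y | ∃ l < r, y = s l}, ∃ t ≤ r + 1, x = h * descProd s r t := by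
  have step : ∀ x l, l < r + 1 →
      (∃ h ∈ Subgroup.closure {y | ∃ l < r, y = s l}, ∃ t ≤ r + 1, x = h * descProd s r t) →
      ∃ h ∈ Subgroup.closure {y | ∃ l < r, y = s l}, ∃ t ≤ r + 1,
        x * s l = h * descProd s r t := by
    rintro _ l hl ⟨h, hh, t, ht, rfl⟩
    rcases (show l + t = r ∨ l + t = r + 1 ∨ l + t < r ∨ r + 1 < l + t by omega)
      with h1 | h1 | h1 | h1
    · exact ⟨h, hh, t + 1, by omega, by
        rw [descProd, show r - t = l by omega, mul_assoc]⟩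
    · obtain ⟨u, rfl⟩ : ∃ u, t = u + 1 := ⟨t - 1, by omega⟩
      exact ⟨h, hh, u, by omega, by
        rw [descProd, show r - u = l by omega, mul_assoc, mul_assoc, hsq l (by omega), mul_one]⟩
    · have hc : Commute (descProd s r t) (s l) := descProd_commute_of_lt hcomm hr h1
      exact ⟨h * s l, mul_mem hh (Subgroup.subset_closure ⟨l, by omega, rfl⟩), t, ht, by
        rw [mul_assoc, hc.eq, mul_assoc]⟩
    · obtain ⟨u, rfl⟩ : ∃ u, l = u + 1 := ⟨l - 1, by omega⟩
      exact ⟨h * s u, mul_mem hh (Subgroup.subset_closure ⟨u, by omega, rfl⟩), t, ht, by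
        rw [mul_assoc, descProd_mul_of_gt hbraid hcomm hr ht (by omega) (by omega), mul_assoc]⟩
  induction hx using Subgroup.closure_induction_right with
  | one => exact ⟨1, one_mem _, 0, by omega, by simp [descProd]⟩
  | mul_right x hx y hy ih =>
    obtain ⟨l, hl, rfl⟩ := hy
    exact step _ l hl ih
  | mul_inv_cancel x hx y hy ih =>
    obtain ⟨l, hl, rfl⟩ := hy
    rw [inv_eq_of_mul_eq_one_right (hsq l (by omega))]
    exact step _ l hl ih

/-- A group generated by involutions satisfying the braid relations acts faithfully as soon as the
generators act as adjacent transpositions. -/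
theorem eq_one_of_mem_closure_of_swap (hsq : ∀ l < R, s l * s l = 1)
    (hbraid : ∀ l, l + 1 < R → s l * s (l + 1) * s l = s (l + 1) * s l * s (l + 1))
    (hcomm : ∀ k l, k + 2 ≤ l → l < R → Commute (s k) (s l))
    {X : Type*} [DecidableEq X] (φ : Q →* Equiv.Perm X) (p : ℕ → X)
    (hp : ∀ k ≤ R, ∀ l ≤ R, p k = p l → k = l)
    (hφ : ∀ l < R, φ (s l) = Equiv.swap (p l) (p (l + 1)))
    {r : ℕ} (hr : r ≤ R) {x : Q} (hx : x ∈ Subgroup.closure {y | ∃ l < r, y = s l})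
    (h1 : φ x = 1) : x = 1 := by
  induction r generalizing x with
  | zero => simpa using hx
  | succ r ih =>
    obtain ⟨h, hh, t, ht, rfl⟩ := exists_eq_mul_descProd hsq hbraid hcomm (by omega) hx
    have hfix : φ h (p (r + 1)) = p (r + 1) := by
      have : Subgroup.closure {y | ∃ l < r, y = s l} ≤
          (MulAction.stabilizer (Equiv.Perm X) (p (r + 1))).comap φ := by
        rw [Subgroup.closure_le]
        rintro _ ⟨l, hl, rfl⟩
        simp only [Subgroup.coe_comap, Set.mem_preimage, SetLike.mem_coe,
          MulAction.mem_stabilizer_iff, Equiv.Perm.smul_def]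
        rw [hφ l (by omega)]
        refine Equiv.swap_apply_of_ne_of_ne (fun e => ?_) (fun e => ?_)
        · have := hp _ (by omega) _ (by omega) e
          omega
        · have := hp _ (by omega) _ (by omega) e
          omega
      exact this hh
    have hdesc : ∀ t ≤ r + 1, φ (descProd s r t) (p (r + 1 - t)) = p (r + 1) := by
      intro t ht
      induction t with
      | zero => simp [descProd]
      | succ t iht =>
        rw [descProd, MonoidHom.map_mul, Equiv.Perm.mul_apply, hφ _ (by omega),
          show r + 1 - (t + 1) = r - t by omega, Equiv.swap_apply_left,
          show r - t + 1 = r + 1 - t by omega, iht (by omega)]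
    have ht0 : p (r + 1) = p (r + 1 - t) := by
      have := congrArg (fun e : Equiv.Perm X => e (p (r + 1 - t))) h1
      simpa [hdesc t ht, hfix] using this
    obtain rfl : t = 0 := by
      have := hp _ (by omega) _ (by omega) ht0
      omega
    rw [descProd, mul_one] at h1 ⊢
    exact ih (by omega) hh h1

end Involutions

/-! ### Relations in the braid group -/

theorem sgen_of_mem {n k : ℕ} (h : 1 ≤ k ∧ k ≤ n) :
    sgen n k = PresentedGroup.of ⟨k - 1, by omega⟩ := dif_pos h

theorem sgen_commute (n : ℕ) {k l : ℕ} (h : k + 2 ≤ l) : Commute (sgen n k) (sgen n l) := by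
  by_cases hk : 1 ≤ k ∧ k ≤ n
  · by_cases hl : 1 ≤ l ∧ l ≤ n
    · have : (PresentedGroup.mk (braidRels n)) (of ⟨k - 1, by omega⟩ * of ⟨l - 1, by omega⟩ *
          (of ⟨k - 1, by omega⟩)⁻¹ * (of ⟨l - 1, by omega⟩)⁻¹) = 1 :=
        PresentedGroup.one_of_mem
          (Or.inl ⟨⟨k - 1, by omega⟩, ⟨l - 1, by omega⟩, Or.inl (by simp only; omega), rfl⟩)
      simp only [_root_.map_mul, _root_.map_inv] at this
      rw [sgen_of_mem hk, sgen_of_mem hl]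
      exact mul_inv_eq_iff_eq_mul.mp (mul_inv_eq_one.mp this)
    · rw [sgen, sgen, dif_neg hl]
      exact Commute.one_right _
  · rw [sgen, dif_neg hk]
    exact Commute.one_left _

theorem sgen_braid {n k : ℕ} (h1 : 1 ≤ k) (h2 : k + 1 ≤ n) :
    sgen n k * sgen n (k + 1) * sgen n k = sgen n (k + 1) * sgen n k * sgen n (k + 1) := by
  have : (PresentedGroup.mk (braidRels n)) (of ⟨k - 1, by omega⟩ * of ⟨k, by omega⟩ *
      of ⟨k - 1, by omega⟩ * (of ⟨k, by omega⟩)⁻¹ * (of ⟨k - 1, by omega⟩)⁻¹ *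
      (of ⟨k, by omega⟩)⁻¹) = 1 :=
    PresentedGroup.one_of_mem
      (Or.inr ⟨⟨k - 1, by omega⟩, ⟨k, by omega⟩, by simp only; omega, rfl⟩)
  simp only [_root_.map_mul, _root_.map_inv] at this
  rw [sgen_of_mem ⟨h1, by omega⟩, sgen_of_mem ⟨by omega, h2⟩]
  exact mul_inv_eq_iff_eq_mul.mp (mul_inv_eq_iff_eq_mul.mp (mul_inv_eq_one.mp this))

theorem agen_self_succ (n i : ℕ) : agen n i (i + 1) = sgen n i ^ 2 := by
  simp [agen, dprod]

theorem agen_succ (n : ℕ) {i j : ℕ} (h : i < j) :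
    agen n i (j + 1) = sgen n j * agen n i j * (sgen n j)⁻¹ := by
  have : dprod n i (j + 1) = sgen n j * dprod n i j := by
    rw [dprod, show j + 1 - 1 - i = (j - 1 - i) + 1 by omega, List.range_succ_eq_map,
      List.map_cons, List.prod_cons, List.map_map, dprod]
    congr 3
    funext t
    simp only [Function.comp_apply]
    congr 1
    omega
  rw [agen, this, agen]
  group

theorem agen_commute_of_lt (n : ℕ) {i j k : ℕ} (hij : i < j) (h : k + 1 < i) :
    Commute (sgen n k) (agen n i j) := by
  induction j, hij using Nat.le_induction with
  | base => rw [agen_self_succ]; exact (sgen_commute n (by omega)).pow_right 2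
  | succ j hj ih =>
    have hc : Commute (sgen n k) (sgen n j) := sgen_commute n (by omega)
    rw [agen_succ n hj]
    exact (hc.mul_right ih).mul_right hc.inv_right

theorem agen_commute_of_gt (n : ℕ) {i j k : ℕ} (hij : i < j) (h : j < k) :
    Commute (sgen n k) (agen n i j) := by
  induction j, hij using Nat.le_induction with
  | base => rw [agen_self_succ]; exact (sgen_commute n (by omega)).symm.pow_right 2
  | succ j hj ih =>
    have hc : Commute (sgen n k) (sgen n j) := (sgen_commute n (by omega)).symm
    rw [agen_succ n hj]
    exact (hc.mul_right (ih (by omega))).mul_right hc.inv_right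

theorem agen_commute_of_between {n i j k : ℕ} (hi : i < k) (hk : k + 2 ≤ j) (hj : j ≤ n + 1) :
    Commute (sgen n k) (agen n i j) := by
  induction j, hk using Nat.le_induction with
  | base =>
    have hc : Commute (sgen n (k + 1)) (agen n i k) := agen_commute_of_gt n hi (by omega)
    have hb := sgen_braid (n := n) (k := k) (by omega) (by omega)
    rw [agen_succ n (show i < k + 1 by omega), agen_succ n hi]
    set a := sgen n k
    set b := sgen n (k + 1)
    have hb' : a * (b * a) = (b * a) * b := by rw [← mul_assoc, hb]
    have ea : a = (b * a) * b * (b * a)⁻¹ := eq_mul_inv_of_mul_eq hb'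
    have ec : b * (a * agen n i k * a⁻¹) * b⁻¹ = (b * a) * agen n i k * (b * a)⁻¹ := by group
    rw [ec]
    have h := (Commute.conj_iff (b * a)).mpr hc
    rwa [← ea] at h
  | succ j hj' ih =>
    have hc : Commute (sgen n k) (sgen n j) := sgen_commute n (by omega)
    rw [agen_succ n (show i < j by omega)]
    exact (hc.mul_right (ih (by omega))).mul_right hc.inv_right

theorem sgen_conj_agen_left {n i j : ℕ} (hi : 1 ≤ i) (hij : i + 2 ≤ j) (hj : j ≤ n + 1) :
    sgen n i * agen n i j * (sgen n i)⁻¹ = agen n (i + 1) j := by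
  induction j, hij using Nat.le_induction with
  | base =>
    have hb := sgen_braid (n := n) (k := i) hi (by omega)
    rw [agen_succ n (show i < i + 1 by omega), agen_self_succ, agen_self_succ]
    set a := sgen n i
    set b := sgen n (i + 1)
    have h1 : SemiconjBy (a * b) (a ^ 2) (b ^ 2) :=
      SemiconjBy.pow_right (show a * b * a = b * (a * b) by rw [hb, mul_assoc]) 2
    calc a * (b * a ^ 2 * b⁻¹) * a⁻¹ = (a * b) * a ^ 2 * (a * b)⁻¹ := by group
      _ = b ^ 2 := by rw [h1.eq]; group
  | succ j hj' ih =>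
    have hc : Commute (sgen n i) (sgen n j) := sgen_commute n (by omega)
    rw [agen_succ n (show i < j by omega), agen_succ n (show i + 1 < j by omega),
      ← ih (by omega)]
    calc _ = (sgen n i * sgen n j) * agen n i j * (sgen n i * sgen n j)⁻¹ := by group
      _ = _ := by rw [hc.eq]; group

/-- The subgroup generated by the `a_{ij}` with `1 ≤ i < j`, `m + 1 ≤ j ≤ m + n`. -/
def pureClosure (m n : ℕ) : Subgroup (BraidGroup (m + n - 1)) :=
  Subgroup.closure {x | ∃ i j : ℕ, 1 ≤ i ∧ i < j ∧ i ≤ m + n - 1 ∧ m + 1 ≤ j ∧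
    j ≤ m + n ∧ x = agen (m + n - 1) i j}

theorem agen_mem_pureClosure {m n i j : ℕ} (hi : 1 ≤ i) (hij : i < j) (hmj : m + 1 ≤ j)
    (hj : j ≤ m + n) : agen (m + n - 1) i j ∈ pureClosure m n :=
  Subgroup.subset_closure ⟨i, j, hi, hij, by omega, hmj, hj, rfl⟩

theorem sgen_sq_mem_pureClosure {m n k : ℕ} (hk : m + 1 ≤ k) (hk' : k ≤ m + n - 1) :
    sgen (m + n - 1) k ^ 2 ∈ pureClosure m n := by
  rw [← agen_self_succ]
  exact agen_mem_pureClosure (by omega) (by omega) (by omega) (by omega)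

theorem sgen_conj_agen_mem {m n i j k : ℕ} (hk : m + 1 ≤ k) (hk' : k ≤ m + n - 1)
    (hi : 1 ≤ i) (hij : i < j) (hmj : m + 1 ≤ j) (hj : j ≤ m + n) :
    sgen (m + n - 1) k * agen (m + n - 1) i j * (sgen (m + n - 1) k)⁻¹ ∈ pureClosure m n := by
  have hsq := sgen_sq_mem_pureClosure hk hk'
  have of_commute : Commute (sgen (m + n - 1) k) (agen (m + n - 1) i j) →
      sgen (m + n - 1) k * agen (m + n - 1) i j * (sgen (m + n - 1) k)⁻¹ ∈ pureClosure m n := by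
    intro hc
    rw [hc.eq, mul_inv_cancel_right]
    exact agen_mem_pureClosure hi hij hmj hj
  have of_conj : ∀ y ∈ pureClosure m n,
      agen (m + n - 1) i j = sgen (m + n - 1) k * y * (sgen (m + n - 1) k)⁻¹ →
      sgen (m + n - 1) k * agen (m + n - 1) i j * (sgen (m + n - 1) k)⁻¹ ∈ pureClosure m n := by
    intro y hy e
    rw [e, show ∀ g : BraidGroup (m + n - 1), g * (g * y * g⁻¹) * g⁻¹ = g ^ 2 * y * (g ^ 2)⁻¹ by
      intro g; simp only [pow_two, mul_inv_rev, mul_assoc]]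
    exact mul_mem (mul_mem hsq hy) (inv_mem hsq)
  rcases lt_trichotomy j k with h | rfl | h
  · exact of_commute (agen_commute_of_gt _ hij h)
  · rw [← agen_succ _ hij]
    exact agen_mem_pureClosure hi (by omega) (by omega) (by omega)
  rcases Nat.lt_or_ge (k + 1) j with h1 | h1
  · rcases lt_trichotomy i k with h2 | rfl | h2
    · exact of_commute (agen_commute_of_between h2 h1 (by omega))
    · rw [sgen_conj_agen_left hi h1 (by omega)]
      exact agen_mem_pureClosure (by omega) h1 hmj hj
    · rcases Nat.lt_or_ge (k + 1) i with h3 | h3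
      · exact of_commute (agen_commute_of_lt _ hij h3)
      · obtain rfl : i = k + 1 := by omega
        exact of_conj _ (agen_mem_pureClosure (i := k) (by omega) h hmj hj)
          (sgen_conj_agen_left (by omega) (by omega) (by omega)).symm
  · obtain rfl : j = k + 1 := by omega
    rcases Nat.lt_or_ge i k with h2 | h2
    · exact of_conj _ (agen_mem_pureClosure hi h2 hk (by omega)) (agen_succ _ h2)
    · obtain rfl : i = k := by omega
      rw [agen_self_succ] at of_commute ⊢
      exact of_commute ((Commute.refl _).pow_right 2)

theorem sgen_mem_normalizer {m n k : ℕ} (hk : m + 1 ≤ k) (hk' : k ≤ m + n - 1) :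
    sgen (m + n - 1) k ∈ Subgroup.normalizer (pureClosure m n : Set _) := by
  set g := sgen (m + n - 1) k
  have hsq : g ^ 2 ∈ pureClosure m n := sgen_sq_mem_pureClosure hk hk'
  have key : ∀ x ∈ pureClosure m n, g * x * g⁻¹ ∈ pureClosure m n := by
    have : pureClosure m n ≤ (pureClosure m n).comap (MulAut.conj g).toMonoidHom := by
      conv_lhs => rw [pureClosure]
      rw [Subgroup.closure_le]
      rintro _ ⟨i, j, hi, hij, -, hmj, hj, rfl⟩
      exact sgen_conj_agen_mem hk hk' hi hij hmj hj
    exact fun x hx => this hx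
  refine Subgroup.mem_normalizer_iff.mpr fun x => ⟨key x, fun hx => ?_⟩
  have := mul_mem (mul_mem (inv_mem hsq) (key _ hx)) hsq
  rwa [show (g ^ 2)⁻¹ * (g * (g * x * g⁻¹) * g⁻¹) * g ^ 2 = x by group] at this

theorem sgen_mem_Bmn {m n k : ℕ} (hk : m + 1 ≤ k) (hk' : k ≤ m + n - 1) :
    sgen (m + n - 1) k ∈ Bmn m n :=
  Subgroup.subset_closure (Or.inr ⟨k, hk, hk', rfl⟩)

theorem Bmn_le_normalizer (m n : ℕ) :
    Bmn m n ≤ Subgroup.normalizer (pureClosure m n : Set _) := by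
  rw [Bmn, Subgroup.closure_le]
  rintro _ (⟨i, j, hi, hij, hmj, hj, rfl⟩ | ⟨k, hk, hk', rfl⟩)
  · exact Subgroup.le_normalizer (agen_mem_pureClosure hi hij hmj hj)
  · exact sgen_mem_normalizer hk hk'

theorem pureClosure_le_Bmn (m n : ℕ) : pureClosure m n ≤ Bmn m n := by
  rw [pureClosure, Subgroup.closure_le]
  rintro _ ⟨i, j, hi, hij, -, hmj, hj, rfl⟩
  exact Subgroup.subset_closure (Or.inl ⟨i, j, hi, hij, hmj, hj, rfl⟩)

theorem pureClosure_le_ker {m n : ℕ} {G : Type*} [Group G] (f : BraidGroup (m + n - 1) →* G)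
    (h : ∀ k, 1 ≤ k → k ≤ m + n - 1 → f (sgen (m + n - 1) k) ^ 2 = 1) :
    pureClosure m n ≤ f.ker := by
  rw [pureClosure, Subgroup.closure_le]
  rintro _ ⟨i, j, hi, -, hin, -, -, rfl⟩
  simp [agen, MonoidHom.mem_ker, h i hi hin]

/-- The intersection of `Bmn m n` with the kernel of a homomorphism sending each `σ_k` to an
adjacent transposition consists of products of the `a_{ij}`. -/
theorem mem_pureClosure_of_mem_ker {m n : ℕ} {X : Type*} [DecidableEq X]
    (f : BraidGroup (m + n - 1) →* Equiv.Perm X) (p : ℕ → X)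
    (hp : ∀ k < m + n, ∀ l < m + n, p k = p l → k = l)
    (hf : ∀ k, k + 1 < m + n → f (sgen (m + n - 1) (k + 1)) = Equiv.swap (p k) (p (k + 1)))
    {x : BraidGroup (m + n - 1)} (hx : x ∈ Bmn m n) (hx1 : f x = 1) : x ∈ pureClosure m n := by
  rcases Nat.eq_zero_or_pos n with rfl | hn
  · have hbot : Bmn m 0 ≤ pureClosure m 0 := by
      rw [Bmn, Subgroup.closure_le]
      rintro _ (⟨i, j, hi, hij, hmj, hj, rfl⟩ | ⟨k, hk, hk', rfl⟩) <;> omega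
    exact hbot hx
  let H := Subgroup.normalizer (pureClosure m n : Set (BraidGroup (m + n - 1)))
  let A : Subgroup H := (pureClosure m n).subgroupOf H
  have hker : pureClosure m n ≤ f.ker := by
    refine pureClosure_le_ker f fun k hk hk' => ?_
    obtain ⟨k, rfl⟩ : ∃ l, k = l + 1 := ⟨k - 1, by omega⟩
    rw [hf k (by omega), pow_two, Equiv.swap_mul_self]
  have hA : ∀ (g : BraidGroup (m + n - 1)) (hg : g ∈ H), ((⟨g, hg⟩ : H) : H ⧸ A) = 1 ↔
      g ∈ pureClosure m n := fun g hg => by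
    rw [QuotientGroup.eq_one_iff, Subgroup.mem_subgroupOf]
  let φ : H ⧸ A →* Equiv.Perm X := QuotientGroup.lift A (f.comp H.subtype) fun a ha => hker ha
  have hs : ∀ l < n - 1, sgen (m + n - 1) (m + 1 + l) ∈ H := fun l hl =>
    sgen_mem_normalizer (by omega) (by omega)
  let s : ℕ → H ⧸ A := fun l =>
    if h : l < n - 1 then ((⟨sgen (m + n - 1) (m + 1 + l), hs l h⟩ : H) : H ⧸ A) else 1
  have hsl : ∀ l (h : l < n - 1), s l = ((⟨_, hs l h⟩ : H) : H ⧸ A) := fun l h => dif_pos h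
  have hcl : ∃ h : x ∈ H, ((⟨x, h⟩ : H) : H ⧸ A) ∈
      Subgroup.closure {y | ∃ l < n - 1, y = s l} := by
    refine ⟨Bmn_le_normalizer m n hx, ?_⟩
    have : Bmn m n ≤ ((Subgroup.closure {y | ∃ l < n - 1, y = s l}).comap
        (QuotientGroup.mk' A)).map H.subtype := by
      rw [Bmn, Subgroup.closure_le]
      rintro _ (⟨i, j, hi, hij, hmj, hj, rfl⟩ | ⟨k, hk, hk', rfl⟩)
      · have hmem := agen_mem_pureClosure hi hij hmj hj
        refine ⟨⟨_, Subgroup.le_normalizer hmem⟩, ?_, rfl⟩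
        rw [SetLike.mem_coe, Subgroup.mem_comap, QuotientGroup.mk'_apply, (hA _ _).mpr hmem]
        exact one_mem _
      · obtain ⟨l, rfl⟩ : ∃ l, k = m + 1 + l := ⟨k - (m + 1), by omega⟩
        have hl : l < n - 1 := by omega
        exact ⟨⟨_, hs l hl⟩, Subgroup.subset_closure ⟨l, hl, (hsl l hl).symm⟩, rfl⟩
    obtain ⟨⟨_, _⟩, hy, rfl⟩ := this hx
    exact hy
  obtain ⟨hxH, hcl⟩ := hcl
  rw [← hA x hxH]
  refine eq_one_of_mem_closure_of_swap (R := n - 1) ?_ ?_ ?_ φ (fun l => p (m + l)) ?_ ?_ le_rfl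
    hcl hx1
  · intro l hl
    rw [hsl l hl, ← QuotientGroup.mk_mul, MulMemClass.mk_mul_mk, hA, ← pow_two]
    exact sgen_sq_mem_pureClosure (by omega) (by omega)
  · intro l hl
    rw [hsl l (by omega), hsl (l + 1) hl]
    simp only [← QuotientGroup.mk_mul, MulMemClass.mk_mul_mk]
    congr 2
    exact sgen_braid (by omega) (by omega)
  · intro k l hkl hl
    rw [hsl k (by omega), hsl l hl, Commute, SemiconjBy]
    simp only [← QuotientGroup.mk_mul, MulMemClass.mk_mul_mk]
    congr 2
    exact sgen_commute _ (by omega)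
  · intro k hk l hl e
    have := hp _ (by omega) _ (by omega) e
    omega
  · intro l hl
    rw [hsl l hl]
    change f (sgen (m + n - 1) (m + 1 + l)) = _
    rw [show m + 1 + l = m + l + 1 by omega, hf _ (by omega)]
    rfl

/-- `P_{m,n} = B_{m,n} ⊓ ker π` is generated by the elements `a_{ij}` with
`1 ≤ i < j`, `i ≤ m+n−1` and `m+1 ≤ j ≤ m+n`.  Here `π` is the unique homomorphism
`B_{m+n} → S_{m+n}` sending each `σ_k` to the transposition `(k, k+1)`. -/
theorem statement10 (m n : ℕ) (hm : 1 ≤ m) (hn : 1 ≤ n)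
    (π : BraidGroup (m + n - 1) →* Equiv.Perm (Fin (m + n)))
    (hπ : ∀ k : ℕ, ∀ _hk1 : 1 ≤ k, ∀ _hk2 : k ≤ m + n - 1,
      π (sgen (m + n - 1) k) =
        Equiv.swap (⟨k - 1, by omega⟩ : Fin (m + n)) (⟨k, by omega⟩ : Fin (m + n))) :
    Bmn m n ⊓ π.ker =
      Subgroup.closure {x | ∃ i j : ℕ, 1 ≤ i ∧ i < j ∧ i ≤ m + n - 1 ∧ m + 1 ≤ j ∧
        j ≤ m + n ∧ x = agen (m + n - 1) i j} := by
  change _ = pureClosure m n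
  apply le_antisymm
  · rintro x ⟨hxB, hxπ⟩
    refine mem_pureClosure_of_mem_ker π
      (fun k => if h : k < m + n then ⟨k, h⟩ else ⟨0, by omega⟩) ?_ ?_ hxB hxπ
    · intro k hk l hl e
      simpa [hk, hl] using e
    · intro k hk
      rw [hπ (k + 1) (by omega) (by omega), dif_pos hk, dif_pos (by omega : k < m + n)]
      rfl
  · refine le_inf (pureClosure_le_Bmn m n) (pureClosure_le_ker π fun k hk hk' => ?_)
    rw [hπ k hk hk', pow_two, Equiv.swap_mul_self]


end BraidPaper
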